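/- Fix a real number t > 0 and an integer k ≥ 1. Set D' = Σ_{j=0}^k t^j/j! − e^t (which is nonzero), and define Q : (0,∞) → ℝ by Q(r) = (r^k e^{−t(r²−1)/2})/2 + e^{−t(r²−1)/2} · ( Σ_{j=0}^k (t r²)^j/j! − e^{t r²} ) / (2 r^k D'). Then Q(1) = 1 and Q'(1) = t^{k+1} / ( k! · ( e^{t} − Σ_{j=0}^k t^j/j! ) ). -/

import Mathlib

/-- The radial part `Q` of the `η`-harmonic extension of `i e^{−ikθ} dθ` on the unit
disk, for the magnetic potential `tη`. -/
noncomputable def stmt9Q (t : ℝ) (k : ℕ) (r : ℝ) : ℝ :=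
  r ^ k * Real.exp (-t * (r ^ 2 - 1) / 2) / 2 +
    Real.exp (-t * (r ^ 2 - 1) / 2) *
        ((∑ j ∈ Finset.range (k + 1), (t * r ^ 2) ^ j / (Nat.factorial j))
          - Real.exp (t * r ^ 2)) /
      (2 * r ^ k *
        ((∑ j ∈ Finset.range (k + 1), t ^ j / (Nat.factorial j)) - Real.exp t))

theorem hasDerivAt_sum_pow_div_factorial (n : ℕ) (x : ℝ) :
    HasDerivAt (fun y : ℝ => ∑ j ∈ Finset.range (n + 1), y ^ j / (Nat.factorial j))
      (∑ j ∈ Finset.range n, x ^ j / (Nat.factorial j)) x := by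
  induction n with
  | zero => simpa using hasDerivAt_const x (1 : ℝ)
  | succ n ih =>
    simp only [Finset.sum_range_succ _ (n + 1)]
    rw [Finset.sum_range_succ]
    refine ih.fun_add ?_
    refine ((hasDerivAt_pow (n + 1) x).div_const (Nat.factorial (n + 1) : ℝ)).congr_deriv ?_
    rw [Nat.factorial_succ]
    push_cast
    field_simp

theorem sum_pow_div_factorial_lt_exp {t : ℝ} (ht : 0 < t) (n : ℕ) :
    ∑ j ∈ Finset.range n, t ^ j / (Nat.factorial j) < Real.exp t := by
  refine lt_of_lt_of_le ?_ (Real.sum_le_exp_of_nonneg ht.le (n + 1))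
  rw [Finset.sum_range_succ]
  have : 0 < t ^ n / (Nat.factorial n : ℝ) := by positivity
  linarith

/-- For `t > 0` and `k ≥ 1`, the denominator
`D' = Σ_{j=0}^k t^j/j! − e^{t}` is nonzero, `Q(1) = 1`, and
`Q'(1) = t^{k+1} / (k! (e^{t} − Σ_{j=0}^k t^j/j!))`, the eigenvalue of the magnetic
Steklov operator. -/
theorem stmt9 (t : ℝ) (ht : 0 < t) (k : ℕ) (hk : 1 ≤ k) :
    ((∑ j ∈ Finset.range (k + 1), t ^ j / (Nat.factorial j)) - Real.exp t) ≠ 0 ∧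
    stmt9Q t k 1 = 1 ∧
    deriv (stmt9Q t k) 1
      = t ^ (k + 1) /
        ((Nat.factorial k) *
          (Real.exp t - ∑ j ∈ Finset.range (k + 1), t ^ j / (Nat.factorial j))) := by
  have hD : (∑ j ∈ Finset.range (k + 1), t ^ j / (Nat.factorial j)) - Real.exp t ≠ 0 :=
    (sub_neg.mpr (sum_pow_div_factorial_lt_exp ht _)).ne
  refine ⟨hD, ?_, ?_⟩
  · simp only [stmt9Q, one_pow, mul_one, sub_self, mul_zero, zero_div, Real.exp_zero, one_mul]
    rw [← div_div, div_right_comm, div_self hD]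
    norm_num
  · have hsq : HasDerivAt (fun r : ℝ => r ^ 2) 2 1 := by
      simpa using hasDerivAt_pow 2 (1 : ℝ)
    have hE : HasDerivAt (fun r : ℝ => Real.exp (-t * (r ^ 2 - 1) / 2)) (-t) 1 := by
      refine (((hsq.sub_const 1).const_mul (-t)).div_const 2).exp.congr_deriv ?_
      simp [neg_div]
    have hpow : HasDerivAt (fun r : ℝ => r ^ k) (k : ℝ) 1 := by
      simpa using hasDerivAt_pow k (1 : ℝ)
    have hS := (((hasDerivAt_sum_pow_div_factorial k (t * 1 ^ 2)).sub
      (Real.hasDerivAt_exp (t * 1 ^ 2))).comp (1 : ℝ) (hsq.const_mul t))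
    have hQ := ((hpow.mul hE).div_const 2).add
      ((hE.mul hS).div ((hpow.const_mul 2).mul_const
        ((∑ j ∈ Finset.range (k + 1), t ^ j / (Nat.factorial j)) - Real.exp t))
        (by simpa using hD))
    refine (hQ.congr_deriv ?_).deriv
    have hneg : Real.exp t - ∑ j ∈ Finset.range (k + 1), t ^ j / (Nat.factorial j) =
      -((∑ j ∈ Finset.range (k + 1), t ^ j / (Nat.factorial j)) - Real.exp t) := by ring
    have hlow : ∑ j ∈ Finset.range k, t ^ j / (Nat.factorial j) - Real.exp t =
        ((∑ j ∈ Finset.range (k + 1), t ^ j / (Nat.factorial j)) - Real.exp t)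
          - t ^ k / (Nat.factorial k) := by
      rw [Finset.sum_range_succ]; ring
    rw [hneg]
    simp only [Function.comp_apply, Pi.sub_apply, Pi.mul_apply, one_pow, mul_one, sub_self,
      mul_zero, zero_div, Real.exp_zero, one_mul, hlow]
    generalize (∑ j ∈ Finset.range (k + 1), t ^ j / (Nat.factorial j : ℝ)) - Real.exp t = D
      at hD ⊢
    field_simp
    ring
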